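/- arXiv:2008.05595 — 2 statements merged into one kernel-verified Lean document; each statement's English description precedes it below -/
import Mathlib

section
/- There is a constant C' depending only on n such that for every nonconstant polynomial p in n real variables of degree d, every multi-index \alpha admissible with respect to p, and every \delta > 0 and r > 0, the Lebesgue volume of V_\delta(p) \cap [-r,r]^n is at most C'\,[ (4d\,\delta^{1/|\alpha|}/|p_\alpha|^{1/|\alpha|})\, r^{n-1} + (4d\,\delta^{1/|\alpha|}/|p_\alpha|^{1/|\alpha|})^n ], where |\alpha| = \alpha_1 + \cdots + \alpha_n. -/
open MvPolynomial MeasureTheory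

/-- A multi-index `α` is *admissible* with respect to the polynomial `p` if `p_α ≠ 0` and
there is a permutation `σ` of the variables such that every other multi-index `β` appearing
in `p` is lexicographically smaller than `α` in the order of variables given by `σ`. -/
def Admissible {n : ℕ} (p : MvPolynomial (Fin n) ℝ) (α : Fin n →₀ ℕ) : Prop :=
  coeff α p ≠ 0 ∧ ∃ σ : Equiv.Perm (Fin n),
    ∀ β : Fin n →₀ ℕ, coeff β p ≠ 0 → β ≠ α →
      ∃ j : Fin n, (∀ k : Fin n, k < j → α (σ k) = β (σ k)) ∧ β (σ j) < α (σ j)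

/-- The cube `[-r, r]^n` in `ℝ^n`. -/
def cube (n : ℕ) (r : ℝ) : Set (Fin n → ℝ) := Set.univ.pi fun _ => Set.Icc (-r) r

/-- The sublevel set `V_δ(p) = {x : |p(x)| < δ}`. -/
def sublevel {n : ℕ} (p : MvPolynomial (Fin n) ℝ) (δ : ℝ) : Set (Fin n → ℝ) :=
  {x | |eval x p| < δ}

lemma oneDim (P : Polynomial ℝ) (a : ℕ) (hd : P.natDegree ≤ a) (c ε : ℝ) (hc : 0 < c)
    (hca : c ≤ |P.coeff a|) (hε : 0 < ε) :
    volume {t : ℝ | |P.eval t| < c * ε ^ a} ≤ ENNReal.ofReal (2 * a * ε) := by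
  have hne : P.coeff a ≠ 0 := by
    intro h
    rw [h, abs_zero] at hca
    linarith
  have hdeg : P.natDegree = a := le_antisymm hd (Polynomial.le_natDegree_of_ne_zero hne)
  set Q : Polynomial ℂ := P.map (algebraMap ℝ ℂ) with hQ
  have hQd : Q.natDegree = a := by rw [hQ, Polynomial.natDegree_map, hdeg]
  have hs : Q.Splits := IsAlgClosed.splits Q
  have hcard : Multiset.card Q.roots = a := by
    rw [← hQd]; exact hs.natDegree_eq_card_roots.symm
  have hlead : Q.leadingCoeff = (P.coeff a : ℂ) := by
    rw [Polynomial.leadingCoeff, hQd, hQ, Polynomial.coeff_map]; rfl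
  have hprod : ∀ t : ℝ, |P.eval t| = |P.coeff a| * (Q.roots.map fun z => ‖(t : ℂ) - z‖).prod := by
    intro t
    have h1 : Q.eval (t : ℂ) = ((P.eval t : ℝ) : ℂ) := by
      rw [hQ, Polynomial.eval_map_algebraMap]
      exact Polynomial.aeval_algebraMap_apply ℂ t P
    have h2 := congrArg (Polynomial.eval (t : ℂ)) hs.eq_prod_roots
    rw [h1, Polynomial.eval_mul, Polynomial.eval_C, hlead, Polynomial.eval_multiset_prod,
      Multiset.map_map] at h2
    have h3 := congrArg norm h2
    rw [Complex.norm_real, norm_mul, Complex.norm_real, Real.norm_eq_abs, Real.norm_eq_abs] at h3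
    rw [h3]
    congr 1
    have := map_multiset_prod (normHom (α := ℂ))
      (Q.roots.map ((Polynomial.eval (t : ℂ)) ∘ fun a => Polynomial.X - Polynomial.C a))
    rw [Multiset.map_map] at this
    simpa [Function.comp_def] using this
  have hsub : {t : ℝ | |P.eval t| < c * ε ^ a} ⊆ ⋃ z ∈ Q.roots.toFinset, Metric.ball z.re ε := by
    intro t ht
    by_contra hcon
    simp only [Set.mem_iUnion, Multiset.mem_toFinset, Metric.mem_ball, not_exists, not_lt] at hcon
    have hge : ∀ z ∈ Q.roots, ε ≤ ‖(t : ℂ) - z‖ := by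
      intro z hz
      refine (hcon z hz).trans ?_
      rw [Real.dist_eq]
      have := Complex.abs_re_le_norm ((t : ℂ) - z)
      simpa using this
    have hp : ∀ s : Multiset ℂ, (∀ z ∈ s, ε ≤ ‖(t : ℂ) - z‖) →
        ε ^ (Multiset.card s) ≤ (s.map fun z => ‖(t : ℂ) - z‖).prod := by
      intro s
      induction s using Multiset.induction_on with
      | empty => simp
      | cons z s ih =>
        intro h
        rw [Multiset.card_cons, Multiset.map_cons, Multiset.prod_cons, pow_succ']
        exact mul_le_mul (h z (by simp)) (ih fun w hw => h w (by simp [hw])) (by positivity)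
          (norm_nonneg _)
    have h5 := hp _ hge
    rw [hcard] at h5
    have ht' : |P.eval t| < c * ε ^ a := ht
    rw [hprod t] at ht'
    have : c * ε ^ a ≤ |P.coeff a| * (Q.roots.map fun z => ‖(t : ℂ) - z‖).prod :=
      mul_le_mul hca h5 (by positivity) (abs_nonneg _)
    linarith
  calc volume {t : ℝ | |P.eval t| < c * ε ^ a}
      ≤ volume (⋃ z ∈ Q.roots.toFinset, Metric.ball z.re ε) := measure_mono hsub
    _ ≤ ∑ z ∈ Q.roots.toFinset, volume (Metric.ball z.re ε) := measure_biUnion_finset_le _ _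
    _ = (Q.roots.toFinset.card : ENNReal) * ENNReal.ofReal (2 * ε) := by
        simp [Real.volume_ball]
    _ ≤ (a : ENNReal) * ENNReal.ofReal (2 * ε) := by
        gcongr
        rw [← hcard]; exact Multiset.toFinset_card_le _
    _ = ENNReal.ofReal (2 * a * ε) := by
        rw [← ENNReal.ofReal_natCast, ← ENNReal.ofReal_mul (by positivity)]
        congr 1; ring

lemma measSub {n : ℕ} (p : MvPolynomial (Fin n) ℝ) (δ : ℝ) : MeasurableSet (sublevel p δ) :=
  (isOpen_lt (p.continuous_eval.abs) continuous_const).measurableSet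

lemma measCube (n : ℕ) (r : ℝ) : MeasurableSet (cube n r) :=
  MeasurableSet.univ_pi fun _ => measurableSet_Icc

lemma volCube (n : ℕ) (r : ℝ) (hr : 0 < r) : volume (cube n r) = ENNReal.ofReal ((2 * r) ^ n) := by
  rw [cube, volume_pi_pi]
  simp only [Real.volume_Icc, Finset.prod_const, Finset.card_univ, Fintype.card_fin]
  rw [← ENNReal.ofReal_pow (by linarith)]
  congr 2; ring

lemma lexBound (n : ℕ) : ∀ (p : MvPolynomial (Fin n) ℝ) (α : Fin n →₀ ℕ), coeff α p ≠ 0 →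
    (∀ β : Fin n →₀ ℕ, coeff β p ≠ 0 → β ≠ α →
      ∃ j : Fin n, (∀ k : Fin n, k < j → α k = β k) ∧ β j < α j) →
    ∀ ε r : ℝ, 0 < ε → 0 < r →
      volume (sublevel p (|coeff α p| * ε ^ (∑ i, α i)) ∩ cube n r) ≤
        ENNReal.ofReal (2 * (∑ i, α i : ℕ) * ε * ((2 * r) ^ n / (2 * r))) := by
  induction n with
  | zero =>
    intro p α hα _ ε r hε hr
    have : sublevel p (|coeff α p| * ε ^ (∑ i, α i)) = ∅ := by
      ext x
      have h1 : α = 0 := Subsingleton.elim _ _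
      have h2 : eval x p = coeff α p := by
        rw [p.eq_C_of_isEmpty]; simp [h1]
      simp [sublevel, h2]
    rw [this]; simp
  | succ n ih =>
    intro p α hα hlex ε r hε hr
    set F := finSuccEquiv ℝ n p with hF
    set a := α 0 with ha
    set q := F.coeff a with hq
    have hαc : α.tail.cons a = α := Finsupp.cons_tail α
    have hcq : coeff α.tail q = coeff α p := by
      rw [hq, hF, finSuccEquiv_coeff_coeff, hαc]
    have hsum : ∑ i, α i = a + ∑ i, α.tail i := by
      rw [Fin.sum_univ_succ]; rfl
    have hq_lex : ∀ β : Fin n →₀ ℕ, coeff β q ≠ 0 → β ≠ α.tail →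
      ∃ j : Fin n, (∀ k : Fin n, k < j → α.tail k = β k) ∧ β j < α.tail j := by
      intro β hβ hne
      rw [hq, hF, finSuccEquiv_coeff_coeff] at hβ
      obtain ⟨j, hj1, hj2⟩ := hlex _ hβ (by
        intro h; apply hne; rw [← h, Finsupp.tail_cons])
      induction j using Fin.cases with
      | zero => simp [ha] at hj2
      | succ j =>
        refine ⟨j, fun k hk => ?_, ?_⟩
        · have := hj1 k.succ (Fin.succ_lt_succ_iff.2 hk)
          rwa [Finsupp.cons_succ] at this
        · rwa [Finsupp.cons_succ] at hj2
    have hdeg : F.natDegree ≤ a := by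
      rw [Polynomial.natDegree_le_iff_coeff_eq_zero]
      intro i hi
      ext m
      rw [hF, finSuccEquiv_coeff_coeff, coeff_zero]
      by_contra hne
      obtain ⟨j, hj1, hj2⟩ := hlex _ hne (by
        intro h
        rw [← h, Finsupp.cons_zero] at ha
        omega)
      induction j using Fin.cases with
      | zero => rw [Finsupp.cons_zero] at hj2; omega
      | succ j =>
        have := hj1 0 (Fin.succ_pos j)
        rw [Finsupp.cons_zero] at this; omega
    have IH := ih q α.tail (by rw [hcq]; exact hα) hq_lex ε r hε hr
    rw [hcq] at IH
    set b := ∑ i, α.tail i with hb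
    set A := sublevel q (|coeff α p| * ε ^ b) ∩ cube n r with hA
    have hAm : MeasurableSet A := (measSub _ _).inter (measCube _ _)
    set S := sublevel p (|coeff α p| * ε ^ (∑ i, α i)) ∩ cube (n+1) r with hS
    have hSm : MeasurableSet S := (measSub _ _).inter (measCube _ _)
    have hmp := (volume_preserving_piFinSuccAbove (fun _ : Fin (n+1) => ℝ) 0).symm
    rw [← hmp.measure_preimage hSm.nullMeasurableSet, Measure.volume_eq_prod,
      Measure.prod_apply_symm (hmp.measurable hSm)]
    have hmem : ∀ (y : Fin n → ℝ) (t : ℝ),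
        (MeasurableEquiv.piFinSuccAbove (fun _ : Fin (n+1) => ℝ) 0).symm (t, y) =
          (Fin.cons t y : Fin (n+1) → ℝ) := by
      intro y t
      simp [MeasurableEquiv.piFinSuccAbove, Fin.insertNthEquiv]
    have hbd : ∀ y : Fin n → ℝ, volume ((fun t : ℝ => (t, y)) ⁻¹'
        ((MeasurableEquiv.piFinSuccAbove (fun _ : Fin (n+1) => ℝ) 0).symm ⁻¹' S)) ≤
        A.indicator (fun _ => ENNReal.ofReal (2 * r)) y +
        (cube n r).indicator (fun _ => ENNReal.ofReal (2 * a * ε)) y := by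
      intro y
      by_cases hy : y ∈ cube n r
      · by_cases hyA : y ∈ A
        · rw [Set.indicator_of_mem hyA]
          refine le_trans ?_ le_self_add
          have : ENNReal.ofReal (2 * r) = volume (Set.Icc (-r) r) := by
            rw [Real.volume_Icc]; congr 1; ring
          rw [this]
          apply measure_mono
          intro t ht
          simp only [Set.mem_preimage, hmem, hS] at ht
          have := ht.2 0 (Set.mem_univ _)
          simpa using this
        · rw [Set.indicator_of_mem hy]
          refine le_trans ?_ le_add_self
          have hge : |coeff α p| * ε ^ b ≤ |eval y q| := by
            by_contra h
            exact hyA ⟨not_le.1 h, hy⟩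
          refine le_trans (measure_mono ?_) (oneDim (F.map (eval y)) a
            (Polynomial.natDegree_map_le.trans hdeg) (|coeff α p| * ε ^ b) ε
            (by positivity) (by rw [Polynomial.coeff_map]; exact hge) hε)
          intro t ht
          simp only [Set.mem_preimage, hmem, hS] at ht
          have h1 : |eval (Fin.cons t y : Fin (n+1) → ℝ) p| < _ := ht.1
          rw [eval_eq_eval_mv_eval', hsum, pow_add] at h1
          change |Polynomial.eval t (F.map (eval y))| < |coeff α p| * ε ^ b * ε ^ a
          refine h1.trans_eq ?_
          ring
      · have : ((fun t : ℝ => (t, y)) ⁻¹'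
          ((MeasurableEquiv.piFinSuccAbove (fun _ : Fin (n+1) => ℝ) 0).symm ⁻¹' S)) = ∅ := by
          rw [Set.eq_empty_iff_forall_notMem]
          intro t ht
          simp only [Set.mem_preimage, hmem, hS] at ht
          apply hy
          intro i _
          have := ht.2 i.succ (Set.mem_univ _)
          simpa using this
        rw [this]; simp
    refine (lintegral_mono hbd).trans ?_
    rw [lintegral_add_left (measurable_const.indicator hAm), lintegral_indicator_const hAm,
      lintegral_indicator_const (measCube n r), volCube n r hr]
    refine (add_le_add_left (mul_le_mul_right IH _) _).trans ?_
    rw [← ENNReal.ofReal_mul (by positivity), ← ENNReal.ofReal_mul (by positivity),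
      ← ENNReal.ofReal_add (by positivity) (by positivity)]
    apply ENNReal.ofReal_le_ofReal
    apply le_of_eq
    rw [hsum]
    push_cast
    field_simp
    ring

lemma permBound (n : ℕ) (p : MvPolynomial (Fin n) ℝ) (α : Fin n →₀ ℕ) (h : Admissible p α)
    (ε r : ℝ) (hε : 0 < ε) (hr : 0 < r) :
      volume (sublevel p (|coeff α p| * ε ^ (∑ i, α i)) ∩ cube n r) ≤
        ENNReal.ofReal (2 * (∑ i, α i : ℕ) * ε * ((2 * r) ^ n / (2 * r))) := by
  obtain ⟨hα, σ, hσ⟩ := h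
  have hc : ∀ β : Fin n →₀ ℕ, coeff (β.mapDomain σ.symm) (rename σ.symm p) = coeff β p :=
    fun β => coeff_rename_mapDomain _ σ.symm.injective p β
  have hv : ∀ (β : Fin n →₀ ℕ) k, β.mapDomain σ.symm k = β (σ k) := by
    intro β k
    have := Finsupp.mapDomain_apply σ.symm.injective β (σ k)
    simpa using this
  have hsum : ∑ i, α.mapDomain σ.symm i = ∑ i, α i := by
    simp only [hv]; exact Equiv.sum_comp σ α
  have key := lexBound n (rename σ.symm p) (α.mapDomain σ.symm) (by rw [hc]; exact hα) (by
    intro β hβ hne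
    obtain ⟨γ, rfl⟩ : ∃ γ : Fin n →₀ ℕ, γ.mapDomain σ.symm = β :=
      ⟨β.mapDomain σ, by rw [← Finsupp.mapDomain_comp]; simp⟩
    rw [hc] at hβ
    obtain ⟨j, h1, h2⟩ := hσ γ hβ (by rintro rfl; exact hne rfl)
    exact ⟨j, fun k hk => by rw [hv, hv]; exact h1 k hk, by rw [hv, hv]; exact h2⟩) ε r hε hr
  rw [hc, hsum] at key
  refine le_trans (le_of_eq ?_) key
  have hmp := volume_measurePreserving_piCongrLeft (fun _ : Fin n => ℝ) σ
  rw [← hmp.measure_preimage ((measSub _ _).inter (measCube _ _)).nullMeasurableSet]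
  congr 1
  have hx : ∀ x : Fin n → ℝ,
      MeasurableEquiv.piCongrLeft (fun _ : Fin n => ℝ) σ x = x ∘ σ.symm := by
    intro x
    ext i
    have := Equiv.piCongrLeft_apply_apply (P := fun _ : Fin n => ℝ) (e := σ) x (σ.symm i)
    rw [Equiv.apply_symm_apply] at this
    exact this
  ext x
  simp only [Set.mem_preimage, hx, Set.mem_inter_iff, sublevel, cube, Set.mem_ofPred_eq,
    eval_rename, Set.mem_univ_pi, Function.comp_apply]
  exact and_congr_right fun _ => σ.symm.forall_congr_left.trans (by simp)

/-- Volume bound for polynomial sublevel sets (Theorem of Dieu et al.): there is a constant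
`C'` depending only on `n` such that for every nonconstant polynomial `p` of degree `d`,
every admissible multi-index `α` for `p`, and every `δ > 0`, `r > 0`,
`vol(V_δ(p) ∩ [-r,r]^n) ≤ C' [ (4d δ^{1/|α|} / |p_α|^{1/|α|}) r^{n-1}
  + (4d δ^{1/|α|} / |p_α|^{1/|α|})^n ]`. -/
theorem volume_sublevel_bound (n : ℕ) :
    ∃ C' : ℝ, 0 < C' ∧
      ∀ (p : MvPolynomial (Fin n) ℝ) (d : ℕ), p.totalDegree = d → 0 < d →
        ∀ α : Fin n →₀ ℕ, Admissible p α →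
          ∀ δ r : ℝ, 0 < δ → 0 < r →
            volume (sublevel p δ ∩ cube n r) ≤
              ENNReal.ofReal (C' *
                ((4 * d / |coeff α p| ^ (((∑ i, α i : ℕ) : ℝ))⁻¹ *
                    δ ^ (((∑ i, α i : ℕ) : ℝ))⁻¹) * r ^ (n - 1) +
                  (4 * d / |coeff α p| ^ (((∑ i, α i : ℕ) : ℝ))⁻¹ *
                    δ ^ (((∑ i, α i : ℕ) : ℝ))⁻¹) ^ n)) := by
  refine ⟨2 ^ n, by positivity, ?_⟩
  intro p d hd hd0 α hadm δ r hδ hr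
  have hα := hadm.1
  have hle : ∑ i, α i ≤ d := by
    rw [← hd]
    have := le_totalDegree (mem_support_iff.2 hα)
    rwa [Finsupp.sum_fintype _ _ (fun _ => rfl)] at this
  have hpos : ∑ i, α i ≠ 0 := by
    intro h0
    have hz : ∀ i, α i = 0 := fun i => by
      have := Finset.sum_eq_zero_iff.1 h0 i (Finset.mem_univ i)
      exact this
    obtain ⟨σ, hσ⟩ := hadm.2
    have : p.totalDegree = 0 := by
      rw [totalDegree_eq_zero_iff]
      intro m hm x
      by_cases hma : m = α
      · rw [hma]; exact hz x
      · obtain ⟨j, -, hj⟩ := hσ m (mem_support_iff.1 hm) hma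
        rw [hz] at hj; omega
    omega
  have hn : n ≠ 0 := by
    rintro rfl
    simp at hpos
  set a := ∑ i, α i with ha
  have hcp : 0 < |coeff α p| := abs_pos.2 hα
  set ε : ℝ := (δ / |coeff α p|) ^ ((a : ℝ))⁻¹ with hεd
  have hε : 0 < ε := Real.rpow_pos_of_pos (by positivity) _
  have hεa : |coeff α p| * ε ^ a = δ := by
    rw [hεd, Real.rpow_inv_natCast_pow (by positivity) hpos]
    field_simp
  have hM : 4 * (d : ℝ) / |coeff α p| ^ ((a : ℝ))⁻¹ * δ ^ ((a : ℝ))⁻¹ = 4 * d * ε := by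
    rw [hεd, Real.div_rpow hδ.le hcp.le]; ring
  have key := permBound n p α hadm ε r hε hr
  rw [← ha, hεa] at key
  refine key.trans ?_
  rw [hM]
  apply ENNReal.ofReal_le_ofReal
  obtain ⟨m, rfl⟩ := Nat.exists_eq_succ_of_ne_zero hn
  have hla : (a : ℝ) ≤ d := by exact_mod_cast hle
  have e1 : (2 * r) ^ (m + 1) / (2 * r) = 2 ^ m * r ^ m := by
    field_simp
    ring
  simp only [Nat.succ_eq_add_one, Nat.add_sub_cancel]
  rw [e1]
  have h1 : 2 * (a : ℝ) * ε * (2 ^ m * r ^ m) ≤ 2 * d * ε * (2 ^ m * r ^ m) := by gcongr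
  have h2 : 0 ≤ (2 : ℝ) ^ (m + 1) * (4 * d * ε) ^ (m + 1) := by positivity
  have h3 : 0 ≤ (d : ℝ) * ε * (2 ^ m * r ^ m) := by positivity
  have h4 : (2 : ℝ) ^ (m + 1) * (4 * d * ε * r ^ m + (4 * d * ε) ^ (m + 1)) =
    8 * (d * ε * (2 ^ m * r ^ m)) + 2 ^ (m + 1) * (4 * d * ε) ^ (m + 1) := by ring
  rw [h4]
  linarith
end

section
/- Fix a degree d \geq 1, let p(x) = \sum_{|\beta| \leq d} p_\beta x^\beta be a nonconstant polynomial in n real variables, \alpha a multi-index admissible with respect to p, and \chi the characteristic function of \{x \in \Delta : p(x) \geq 0\}. Endow the finite-dimensional space of moment vectors s(g) = (s_\beta(g))_{|\beta| \leq d} with any norm \|\cdot\|. Then there exist constants K > 0 and \rho > 0 (depending on p, \alpha, n and the chosen norm) such that \|\chi - g\|_1 \leq K\, \| s(\chi) - s(g) \|^{1/(|\alpha|+1)} for every measurable g : \Delta \to [0,1] with \|\chi - g\|_1 \leq \rho. -/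
open MvPolynomial MeasureTheory

/-- The characteristic function of `E = {x ∈ Δ : p(x) ≥ 0}`. -/
noncomputable def chiP {n : ℕ} (p : MvPolynomial (Fin n) ℝ) : (Fin n → ℝ) → ℝ :=
  Set.indicator {x ∈ cube n 1 | 0 ≤ eval x p} 1

/-- The (finite) index set of multi-indices of total degree at most `d`. -/
def MIdx (n d : ℕ) : Type := {β : Fin n → Fin (d + 1) // (∑ i, (β i : ℕ)) ≤ d}

/-- The moment vector `s(h) = (s_β(h))_{|β| ≤ d}` of a function `h` on `Δ = [-1,1]^n`,
where `s_β(h) = ∫_Δ x^β h dλ`. -/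
noncomputable def momentVec (n d : ℕ) (h : (Fin n → ℝ) → ℝ) : MIdx n d → ℝ :=
  fun β => ∫ x in cube n 1, (∏ i, x i ^ (β.1 i : ℕ)) * h x


/-- The one-dimensional measure: Lebesgue measure on `[-1,1]`. -/
noncomputable def nuOne : Measure ℝ := (volume : Measure ℝ).restrict (Set.Icc (-1) 1)

instance : IsFiniteMeasure nuOne := by unfold nuOne; infer_instance

lemma nuOne_univ : nuOne Set.univ = 2 := by
  simp [nuOne]; norm_num

/-- Univariate sublevel estimate. -/
lemma sublevel_one (q : Polynomial ℝ) (t : ℝ) (ht : 0 < t) :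
    nuOne {x | |q.eval x| < |q.leadingCoeff| * t ^ q.natDegree} ≤
      ENNReal.ofReal (2 * q.natDegree * t) := by
  classical
  set Q : Polynomial ℂ := q.map (algebraMap ℝ ℂ) with hQ
  have hs : Q.Splits := IsAlgClosed.splits Q
  have hdeg : Q.natDegree = q.natDegree := Polynomial.natDegree_map _
  have hlc : Q.leadingCoeff = (q.leadingCoeff : ℂ) := Polynomial.leadingCoeff_map _
  have hcard := hs.natDegree_eq_card_roots
  have hsub : {x | |q.eval x| < |q.leadingCoeff| * t ^ q.natDegree} ⊆
      ⋃ z ∈ Q.roots.toFinset, Metric.ball z.re t := by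
    intro x hx
    simp only [Set.mem_ofPred_eq] at hx
    by_contra hcon
    simp only [Set.mem_iUnion, not_exists, Multiset.mem_toFinset, Metric.mem_ball,
      Real.dist_eq, not_lt] at hcon
    have h1 := hs.eval_eq_prod_roots (x : ℂ)
    have h2 : Q.eval (x : ℂ) = ((q.eval x : ℝ) : ℂ) := by
      rw [hQ, Polynomial.eval_map]
      exact Polynomial.eval₂_at_apply (algebraMap ℝ ℂ) x
    have h3 : |q.eval x| = |q.leadingCoeff| *
        (Q.roots.map (fun a => ‖(x : ℂ) - a‖)).prod := by
      have := congrArg (fun z : ℂ => ‖z‖) h1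
      simp only [h2, hlc, norm_mul, Complex.norm_real, Real.norm_eq_abs] at this
      rw [this]
      congr 1
      have := map_multiset_prod (normHom : ℂ →*₀ ℝ) (Q.roots.map (fun a => (x : ℂ) - a))
      rw [Multiset.map_map] at this
      simpa using this
    have h4 : t ^ q.natDegree ≤ (Q.roots.map (fun a => ‖(x : ℂ) - a‖)).prod := by
      rw [← hdeg, hcard, ← Multiset.prod_replicate, ← Multiset.map_const']
      apply Multiset.prod_map_le_prod_map₀
      · intro _ _; exact ht.le
      · intro a ha
        refine (hcon a ha).trans ?_
        have := Complex.abs_re_le_norm ((x : ℂ) - a)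
        simpa using this
    rw [h3] at hx
    exact absurd hx (not_lt.2 (mul_le_mul_of_nonneg_left h4 (abs_nonneg _)))
  calc nuOne _ ≤ volume {x | |q.eval x| < |q.leadingCoeff| * t ^ q.natDegree} :=
        Measure.restrict_apply_le _ _
    _ ≤ volume (⋃ z ∈ Q.roots.toFinset, Metric.ball z.re t) := measure_mono hsub
    _ ≤ ∑ z ∈ Q.roots.toFinset, volume (Metric.ball z.re t) := measure_biUnion_finset_le _ _
    _ = (Q.roots.toFinset.card : ENNReal) * ENNReal.ofReal (2 * t) := by
        simp [Real.volume_ball]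
    _ ≤ (q.natDegree : ENNReal) * ENNReal.ofReal (2 * t) := by
        gcongr
        rw [← hdeg, hcard]
        exact Multiset.toFinset_card_le _
    _ = ENNReal.ofReal (2 * q.natDegree * t) := by
        rw [← ENNReal.ofReal_natCast, ← ENNReal.ofReal_mul (by positivity)]
        congr 1; ring

/-- Multivariate sublevel estimate, identity permutation. -/
lemma sublevel_id : ∀ (n : ℕ) (p : MvPolynomial (Fin n) ℝ) (α : Fin n →₀ ℕ)
    (_ : coeff α p ≠ 0)
    (_ : ∀ β : Fin n →₀ ℕ, coeff β p ≠ 0 → β ≠ α →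
      ∃ j : Fin n, (∀ k : Fin n, k < j → α k = β k) ∧ β j < α j) (t : ℝ) (_ : 0 < t),
    Measure.pi (fun _ : Fin n => nuOne) {x | |eval x p| < |coeff α p| * t ^ (∑ i, α i)} ≤
      ENNReal.ofReal (2 ^ n * (∑ i, α i : ℕ) * t) := by
  intro n
  induction n with
  | zero =>
    intro p α h0 _ t ht
    have : {x : Fin 0 → ℝ | |eval x p| < |coeff α p| * t ^ (∑ i, α i)} = ∅ := by
      ext x
      rw [MvPolynomial.eq_C_of_isEmpty p]
      simp [Subsingleton.elim α 0]
    rw [this]; simp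
  | succ n ih =>
    intro p α h0 hlex t ht
    set P := finSuccEquiv ℝ n p with hP
    set a := α 0 with ha
    set α' := α.tail with hα'
    have hαc : α'.cons a = α := Finsupp.cons_tail α
    set c := P.coeff a with hc
    have hcc : ∀ β, coeff β c = coeff (β.cons a) p := fun β => finSuccEquiv_coeff_coeff β p a
    have hcα : coeff α' c = coeff α p := by rw [hcc, hαc]
    have hsum : ∑ i, α i = a + ∑ i, α' i := by
      rw [Fin.sum_univ_succ]; rfl
    have hlex' : ∀ β : Fin n →₀ ℕ, coeff β c ≠ 0 → β ≠ α' →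
        ∃ j : Fin n, (∀ k : Fin n, k < j → α' k = β k) ∧ β j < α' j := by
      intro β hβ hne
      rw [hcc] at hβ
      obtain ⟨j, hj1, hj2⟩ := hlex _ hβ (by
        intro h; apply hne; rw [hα', ← h, Finsupp.tail_cons])
      induction j using Fin.cases with
      | zero => simp [ha] at hj2
      | succ j =>
        refine ⟨j, fun k hk => ?_, ?_⟩
        · have := hj1 k.succ (by simpa using hk)
          simpa [hα', Finsupp.tail_apply] using this
        · simpa [hα', Finsupp.tail_apply] using hj2
    have hdeg : P.natDegree ≤ a := by
      rw [Polynomial.natDegree_le_iff_coeff_eq_zero]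
      intro i hi
      ext m
      rw [finSuccEquiv_coeff_coeff, coeff_zero]
      by_contra hm
      obtain ⟨j, hj1, hj2⟩ := hlex _ hm (by
        intro h
        have := DFunLike.congr_fun h 0
        simp at this; omega)
      induction j using Fin.cases with
      | zero => simp at hj2; omega
      | succ j =>
        have := hj1 0 (Fin.succ_pos j)
        simp at this; omega
    have ihc := ih c α' (by rwa [hcα]) hlex' t ht
    rw [hcα] at ihc
    set A' : Set (Fin n → ℝ) := {y | |eval y c| < |coeff α p| * t ^ (∑ i, α' i)} with hA'
    have hA'm : MeasurableSet A' :=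
      (isOpen_lt (MvPolynomial.continuous_eval _).abs continuous_const).measurableSet
    set E : Set (Fin (n+1) → ℝ) := {x | |eval x p| < |coeff α p| * t ^ (∑ i, α i)} with hE
    have hEm : MeasurableSet E :=
      (isOpen_lt (MvPolynomial.continuous_eval _).abs continuous_const).measurableSet
    have mp := (measurePreserving_piFinSuccAbove (fun _ : Fin (n+1) => nuOne) 0).symm
    have key : ∀ y : Fin n → ℝ, nuOne {x | (Fin.cons x y : Fin (n+1) → ℝ) ∈ E} ≤
        A'.indicator (fun _ => 2) y + ENNReal.ofReal (2 * a * t) := by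
      intro y
      by_cases hy : y ∈ A'
      · rw [Set.indicator_of_mem hy]
        exact ((measure_mono (Set.subset_univ _)).trans nuOne_univ.le).trans le_self_add
      · rw [Set.indicator_of_notMem hy, zero_add]
        have hy' : |coeff α p| * t ^ (∑ i, α' i) ≤ |eval y c| := not_lt.1 hy
        have hcy : eval y c ≠ 0 := by
          have : 0 < |coeff α p| * t ^ (∑ i, α' i) := by positivity
          exact abs_pos.1 (this.trans_le hy')
        set q := P.map (eval y) with hq
        have hqa : q.coeff a = eval y c := by rw [hq, Polynomial.coeff_map]
        have hqd : q.natDegree = a := by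
          apply le_antisymm
          · exact Polynomial.natDegree_map_le.trans hdeg
          · exact Polynomial.le_natDegree_of_ne_zero (by rwa [hqa])
        have hlc : q.leadingCoeff = eval y c := by rw [Polynomial.leadingCoeff, hqd, hqa]
        have := sublevel_one q t ht
        rw [hlc, hqd] at this
        refine le_trans (measure_mono ?_) this
        intro x hx
        simp only [hE, Set.mem_ofPred_eq] at hx ⊢
        rw [eval_eq_eval_mv_eval'] at hx
        refine hx.trans_le ?_
        rw [hsum, pow_add]
        calc _ = (|coeff α p| * t ^ (∑ i, α' i)) * t ^ a := by ring
          _ ≤ _ := by gcongr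
    have h1 : Measure.pi (fun _ : Fin (n+1) => nuOne) E =
        ∫⁻ y, nuOne {x | (Fin.cons x y : Fin (n+1) → ℝ) ∈ E}
          ∂(Measure.pi (fun _ : Fin n => nuOne)) := by
      rw [← mp.measure_preimage hEm.nullMeasurableSet,
        Measure.prod_apply_symm (mp.measurable hEm)]
      refine lintegral_congr fun y => ?_
      congr 1
      ext x
      simp [MeasurableEquiv.piFinSuccAbove, Fin.insertNthEquiv]
    rw [h1]
    refine (lintegral_mono key).trans ?_
    rw [lintegral_add_right _ measurable_const, lintegral_indicator hA'm, setLIntegral_const,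
      lintegral_const, Measure.pi_univ]
    simp only [nuOne_univ, Finset.prod_const, Finset.card_univ, Fintype.card_fin]
    have h2 : (2 : ENNReal) = ENNReal.ofReal 2 := by simp
    rw [h2, ← ENNReal.ofReal_pow (by norm_num), ← ENNReal.ofReal_mul (by positivity)]
    refine (add_le_add_left (mul_le_mul_right ihc _) _).trans ?_
    rw [← ENNReal.ofReal_mul (by norm_num), ← ENNReal.ofReal_add (by positivity) (by positivity)]
    apply ENNReal.ofReal_le_ofReal
    rw [hsum]; push_cast
    apply le_of_eq; ring

/-- Multivariate sublevel estimate. -/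
lemma sublevel_s8 {n : ℕ} (p : MvPolynomial (Fin n) ℝ) (α : Fin n →₀ ℕ) (hα : Admissible p α)
    (t : ℝ) (ht : 0 < t) :
    (volume.restrict (cube n 1)) {x | |eval x p| < |coeff α p| * t ^ (∑ i, α i)} ≤
      ENNReal.ofReal (2 ^ n * (∑ i, α i : ℕ) * t) := by
  obtain ⟨h0, σ, hσ⟩ := hα
  have hvol : (volume.restrict (cube n 1) : Measure (Fin n → ℝ)) =
      Measure.pi (fun _ : Fin n => nuOne) := by
    rw [cube, volume_pi, Measure.restrict_pi_pi]; rfl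
  rw [hvol]
  set q := rename σ.symm p with hq
  set γ := α.mapDomain σ.symm with hγ
  have hmap : ∀ (β : Fin n →₀ ℕ) k, β.mapDomain σ.symm k = β (σ k) := by
    intro β k
    have := Finsupp.mapDomain_apply σ.symm.injective β (σ k)
    simpa using this
  have hco : ∀ β : Fin n →₀ ℕ, coeff (β.mapDomain σ.symm) q = coeff β p :=
    fun β => coeff_rename_mapDomain _ σ.symm.injective p β
  have hsum : ∑ i, γ i = ∑ i, α i := by
    simp only [hγ, hmap]
    exact Equiv.sum_comp σ (fun i => α i)
  have main := sublevel_id n q γ (by rw [hco]; exact h0) (by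
    intro β hβ hne
    have hβ' : β = (β.mapDomain σ).mapDomain σ.symm := by
      rw [← Finsupp.mapDomain_comp]; simp
    rw [hβ', hco] at hβ
    obtain ⟨j, hj1, hj2⟩ := hσ _ hβ (by
      intro h; apply hne; rw [hβ', h])
    rw [hβ']
    refine ⟨j, fun k hk => ?_, ?_⟩
    · rw [hγ, hmap, hmap]; exact hj1 k hk
    · rw [hγ, hmap, hmap]; exact hj2) t ht
  rw [hco, hsum] at main
  refine le_trans (le_of_eq ?_) main
  have mp := measurePreserving_piCongrLeft (α := fun _ : Fin n => ℝ)
    (fun _ : Fin n => nuOne) σ.symm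
  have hm : MeasurableSet {x : Fin n → ℝ | |eval x q| < |coeff α p| * t ^ (∑ i, α i)} :=
      (isOpen_lt (MvPolynomial.continuous_eval _).abs continuous_const).measurableSet
  rw [← mp.measure_preimage hm.nullMeasurableSet]
  congr 1
  ext x
  simp only [Set.mem_ofPred_eq, Set.mem_preimage, hq, eval_rename]
  have : ((MeasurableEquiv.piCongrLeft (fun _ : Fin n => ℝ) σ.symm) x) ∘ σ.symm = x := by
    ext i
    simp [MeasurableEquiv.coe_piCongrLeft, Equiv.piCongrLeft_apply]
  rw [this]

/-- A linear functional is bounded by any norm in finite dimension. -/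
lemma functional_bound {V : Type*} [AddCommGroup V] [Module ℝ V] [FiniteDimensional ℝ V]
    (N : Seminorm ℝ V) (hN : ∀ v, N v = 0 → v = 0) (L : V →ₗ[ℝ] ℝ) :
    ∃ C : ℝ, 0 < C ∧ ∀ v, |L v| ≤ C * N v := by
  let _ : Norm V := ⟨N⟩
  have core : NormedSpace.Core ℝ V :=
    { norm_nonneg := fun x => apply_nonneg N x
      norm_smul := fun c x => map_smul_eq_mul N c x
      norm_triangle := fun x y => map_add_le_add N x y
      norm_eq_zero_iff := fun x => ⟨hN x, fun h => by rw [h]; exact map_zero N⟩ }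
  let _ : NormedAddCommGroup V := NormedAddCommGroup.ofCore core
  let _ : NormedSpace ℝ V := NormedSpace.ofCore core
  let L' := LinearMap.toContinuousLinearMap L
  refine ⟨‖L'‖ + 1, by positivity, fun v => ?_⟩
  have h1 : ‖L' v‖ ≤ ‖L'‖ * ‖v‖ := L'.le_opNorm v
  have h2 : (0 : ℝ) ≤ ‖v‖ := norm_nonneg v
  change ‖L' v‖ ≤ (‖L'‖ + 1) * ‖v‖
  linarith

/-- Hölder continuity of the inverse moment map in an arbitrary norm on the moment space:
for a nonconstant polynomial `p` of degree at most `d` with admissible multi-index `α` and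
any norm `N` on the space of moment vectors of degree `d`, there are constants `K, ρ > 0`
such that `‖χ - g‖₁ ≤ K ‖s(χ) - s(g)‖^{1/(|α|+1)}` for all measurable `g : Δ → [0,1]`
with `‖χ - g‖₁ ≤ ρ`. -/
theorem moment_map_holder {n : ℕ} (d : ℕ) (hd : 1 ≤ d) (p : MvPolynomial (Fin n) ℝ)
    (hp : 0 < p.totalDegree) (hpd : p.totalDegree ≤ d)
    (α : Fin n →₀ ℕ) (hα : Admissible p α)
    (N : Seminorm ℝ (MIdx n d → ℝ)) (hN : ∀ v, N v = 0 → v = 0) :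
    ∃ K ρ : ℝ, 0 < K ∧ 0 < ρ ∧
      ∀ g : (Fin n → ℝ) → ℝ, Measurable g → (∀ x, g x ∈ Set.Icc (0 : ℝ) 1) →
        (∫ x in cube n 1, |chiP p x - g x|) ≤ ρ →
        (∫ x in cube n 1, |chiP p x - g x|) ≤
          K * (N (momentVec n d (chiP p) - momentVec n d g)) ^
            ((((∑ i, α i : ℕ) : ℝ)) + 1)⁻¹ := by
  classical
  haveI : Finite (MIdx n d) :=
    inferInstanceAs (Finite {β : Fin n → Fin (d + 1) // (∑ i, (β i : ℕ)) ≤ d})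
  have hb : ∀ b ∈ p.support, ∑ i, b i ≤ d := by
    intro b hb
    have := le_totalDegree hb
    rw [Finsupp.sum_fintype _ _ (fun _ => rfl)] at this
    exact this.trans hpd
  let toM : p.support → MIdx n d := fun b =>
    ⟨fun i => ⟨b.1 i, Nat.lt_succ_of_le
      ((Finset.single_le_sum (f := fun i => b.1 i) (fun _ _ => Nat.zero_le _)
        (Finset.mem_univ i)).trans (hb b.1 b.2))⟩, hb b.1 b.2⟩
  let L : (MIdx n d → ℝ) →ₗ[ℝ] ℝ :=
    ∑ b : p.support, (coeff b.1 p) • LinearMap.proj (toM b)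
  obtain ⟨C, hC, hCN⟩ := functional_bound N hN L
  set m := ∑ i, α i with hm
  set κ := |coeff α p| with hκ
  have hκ0 : 0 < κ := abs_pos.2 hα.1
  set D : ℝ := 2 ^ n * (m : ℕ) with hD
  have hD0 : 0 ≤ D := by positivity
  refine ⟨D + C / κ, 1, by positivity, one_pos, ?_⟩
  intro g hg hg01 _
  set μ : Measure (Fin n → ℝ) := volume.restrict (cube n 1) with hμ
  have hcubeC : IsCompact (cube n 1) := isCompact_univ_pi fun _ => isCompact_Icc
  have hcm : MeasurableSet (cube n 1) := hcubeC.measurableSet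
  haveI : IsFiniteMeasure μ := ⟨by
    rw [hμ, Measure.restrict_apply_univ]; exact hcubeC.measure_lt_top⟩
  have hpc : Continuous fun x : Fin n → ℝ => eval x p := MvPolynomial.continuous_eval p
  have hχm : Measurable (chiP p) :=
    measurable_one.indicator (hcm.inter (measurableSet_le measurable_const hpc.measurable))
  have hχ01 : ∀ x, chiP p x ∈ Set.Icc (0 : ℝ) 1 := by
    intro x
    unfold chiP
    by_cases h : x ∈ {x ∈ cube n 1 | 0 ≤ eval x p}
    · rw [Set.indicator_of_mem h]; simp
    · rw [Set.indicator_of_notMem h]; simp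
  have hcont : ∀ (u h : (Fin n → ℝ) → ℝ), Continuous u → Measurable h →
      (∀ x, h x ∈ Set.Icc (0 : ℝ) 1) → Integrable (fun x => u x * h x) μ := by
    intro u h hu hh h01
    have h1 : Integrable u μ := hu.continuousOn.integrableOn_compact hcubeC
    refine h1.mul_bdd (c := 1) hh.aestronglyMeasurable (Filter.Eventually.of_forall fun x => ?_)
    rw [Real.norm_eq_abs, abs_of_nonneg (h01 x).1]
    exact (h01 x).2
  have hmono : ∀ b : Fin n →₀ ℕ, Continuous fun x : Fin n → ℝ => ∏ i, x i ^ (b i) := by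
    intro b; fun_prop
  -- the functional applied to the moments
  have hLs : ∀ h : (Fin n → ℝ) → ℝ, Measurable h → (∀ x, h x ∈ Set.Icc (0 : ℝ) 1) →
      L (momentVec n d h) = ∫ x, eval x p * h x ∂μ := by
    intro h hh h01
    have e1 : ∀ x, eval x p * h x =
        ∑ b : p.support, coeff b.1 p * ((∏ i, x i ^ (b.1 i)) * h x) := by
      intro x
      rw [eval_eq', ← Finset.sum_coe_sort, Finset.sum_mul]
      exact Finset.sum_congr rfl fun b _ => by ring
    simp_rw [e1]
    rw [integral_finsetSum _ (fun b _ => (hcont _ h (hmono b.1) hh h01).const_mul _)]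
    simp only [L, LinearMap.sum_apply, LinearMap.smul_apply, LinearMap.proj_apply, smul_eq_mul]
    refine Finset.sum_congr rfl fun b _ => ?_
    rw [integral_const_mul]
    rfl
  set v := momentVec n d (chiP p) - momentVec n d g with hv
  have hpf : Integrable (fun x => eval x p * (chiP p x - g x)) μ := by
    have := (hcont _ _ hpc hχm hχ01).sub (hcont _ _ hpc hg hg01)
    refine this.congr (Filter.Eventually.of_forall fun x => ?_)
    simp [mul_sub]
  have hM : ∫ x, eval x p * (chiP p x - g x) ∂μ ≤ C * N v := by
    have : L v = ∫ x, eval x p * (chiP p x - g x) ∂μ := by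
      rw [hv, map_sub, hLs _ hχm hχ01, hLs _ hg hg01,
        ← integral_sub (hcont _ _ hpc hχm hχ01) (hcont _ _ hpc hg hg01)]
      simp only [mul_sub]
    rw [← this]
    exact (le_abs_self _).trans (hCN v)
  have hfi : Integrable (fun x => |chiP p x - g x|) μ := by
    have h1 := (hcont (fun _ => 1) _ continuous_const hχm hχ01).sub
      (hcont (fun _ => 1) _ continuous_const hg hg01)
    refine h1.abs.congr (Filter.Eventually.of_forall fun x => ?_)
    simp
  have hsign : ∀ x ∈ cube n 1,
      eval x p * (chiP p x - g x) = |eval x p| * |chiP p x - g x| := by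
    intro x hx
    by_cases h : 0 ≤ eval x p
    · have : chiP p x = 1 := by
        unfold chiP
        rw [Set.indicator_of_mem (show x ∈ {x ∈ cube n 1 | 0 ≤ eval x p} from ⟨hx, h⟩)]; rfl
      rw [this, abs_of_nonneg h, abs_of_nonneg (sub_nonneg.2 (hg01 x).2)]
    · have : chiP p x = 0 := by
        unfold chiP
        rw [Set.indicator_of_notMem]
        exact fun hh => h hh.2
      rw [this, abs_of_neg (not_le.1 h), abs_of_nonpos (by linarith [(hg01 x).1])]
      ring
  have hle1 : ∀ x, |chiP p x - g x| ≤ 1 := by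
    intro x
    have h1 := hχ01 x
    have h2 := hg01 x
    rw [abs_le]; constructor <;> linarith [h1.1, h1.2, h2.1, h2.2]
  have key : ∀ t : ℝ, 0 < t → N v ≤ t ^ (m + 1) →
      ∫ x, |chiP p x - g x| ∂μ ≤ (D + C / κ) * t := by
    intro t ht hNt
    set S : Set (Fin n → ℝ) := {x | |eval x p| < κ * t ^ m} with hS
    have hSm : MeasurableSet S := (isOpen_lt hpc.abs continuous_const).measurableSet
    have hSμ : μ.real S ≤ D * t := by
      have := sublevel_s8 p α hα t ht
      exact ENNReal.toReal_le_of_le_ofReal (by positivity) this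
    have hct : 0 < κ * t ^ m := by positivity
    have hind : Integrable (S.indicator (fun _ => (1 : ℝ))) μ :=
      (integrable_const _).indicator hSm
    calc ∫ x, |chiP p x - g x| ∂μ
        ≤ ∫ x, (S.indicator (fun _ => (1 : ℝ)) x +
            (κ * t ^ m)⁻¹ * (eval x p * (chiP p x - g x))) ∂μ := by
          refine integral_mono_ae hfi (hind.add (hpf.const_mul _)) ?_
          filter_upwards [ae_restrict_mem hcm] with x hx
          rw [hsign x hx]
          by_cases hxS : x ∈ S
          · rw [Set.indicator_of_mem hxS]
            have : 0 ≤ (κ * t ^ m)⁻¹ * (|eval x p| * |chiP p x - g x|) := by positivity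
            linarith [hle1 x]
          · rw [Set.indicator_of_notMem hxS, zero_add, ← mul_assoc]
            have h1 : κ * t ^ m ≤ |eval x p| := not_lt.1 hxS
            have h2 : 1 ≤ (κ * t ^ m)⁻¹ * |eval x p| := by
              rw [inv_mul_eq_div, one_le_div hct]; exact h1
            exact le_mul_of_one_le_left (abs_nonneg _) h2
      _ = μ.real S + (κ * t ^ m)⁻¹ * ∫ x, eval x p * (chiP p x - g x) ∂μ := by
          rw [integral_add hind (hpf.const_mul _), integral_const_mul,
            integral_indicator_const _ hSm]
          simp
      _ ≤ D * t + (κ * t ^ m)⁻¹ * (C * t ^ (m + 1)) := by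
          gcongr
          exact hM.trans (by gcongr)
      _ = (D + C / κ) * t := by
          field_simp
          ring
  set T := N v ^ (((m : ℕ) : ℝ) + 1)⁻¹ with hT
  have hNv : 0 ≤ N v := apply_nonneg N v
  have hT0 : 0 ≤ T := Real.rpow_nonneg hNv _
  have hTm : T ^ (m + 1) = N v := by
    have := Real.rpow_inv_natCast_pow hNv (Nat.succ_ne_zero m)
    rw [hT]
    simpa using this
  have hK : 0 < D + C / κ := by positivity
  rw [← div_le_iff₀' hK]
  refine le_of_forall_gt_imp_ge_of_dense fun t ht => ?_
  rw [div_le_iff₀' hK]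
  refine key t (hT0.trans_lt ht) ?_
  rw [← hTm]
  gcongr
end
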